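/- arXiv:2507.21374 — 6 statements merged into one kernel-verified Lean document; each statement's English description precedes it below -/
import Mathlib

section
/- Let Δt > 0 and let α, γ₀ be real numbers with α > −1 and αγ₀ > −1. With the measurement schedule t_k = Δt·k^α, total time T_m = ∑_{k=1}^m t_k, cumulative information I_m = ∑_{k=1}^m t_k^{γ₀}, and exponent p = (αγ₀ + 1)/(α + 1), one has lim_{m→∞} I_m / T_m^{p} = Δt^{γ₀ − p} · (α+1)^{p} / (αγ₀ + 1). In particular I_m = Θ(T_m^{p}) as m → ∞. -/
open Filter

/-- The backward difference quotient of `x ↦ x ^ (s + 1)` at `n + 1`, normalized by `(n + 1) ^ s`,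
tends to `s + 1`. -/
theorem tendsto_rpow_add_one_sub_rpow_div (s : ℝ) :
    Tendsto (fun n : ℕ => (((n : ℝ) + 1) ^ (s + 1) - (n : ℝ) ^ (s + 1)) / ((n : ℝ) + 1) ^ s)
      atTop (nhds (s + 1)) := by
  have hderiv : HasDerivAt (fun x : ℝ => x ^ (s + 1)) (s + 1) 1 := by
    simpa using Real.hasDerivAt_rpow_const (x := 1) (p := s + 1) (Or.inl one_ne_zero)
  have hpoint : Tendsto (fun n : ℕ => 1 - 1 / ((n : ℝ) + 1)) atTop (nhdsWithin 1 {1}ᶜ) := by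
    refine tendsto_nhdsWithin_iff.2 ⟨?_, .of_forall fun n => ?_⟩
    · simpa using tendsto_one_div_add_atTop_nhds_zero_nat.const_sub (1 : ℝ)
    · have : (0 : ℝ) < 1 / ((n : ℝ) + 1) := by positivity
      simp only [Set.mem_compl_iff, Set.mem_singleton_iff]
      linarith
  refine (hderiv.tendsto_slope.comp hpoint).congr fun n => ?_
  have hn : (0 : ℝ) < (n : ℝ) + 1 := by positivity
  have hfrac : 1 - 1 / ((n : ℝ) + 1) = n / (n + 1) := by
    field_simp
    ring
  have hpow : (0 : ℝ) < ((n : ℝ) + 1) ^ s := by positivity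
  rw [Function.comp_apply, slope_def_field, hfrac, Real.div_rpow n.cast_nonneg hn.le,
    Real.one_rpow, Real.rpow_add_one hn.ne']
  field_simp
  ring

/-- `∑_{k=1}^m k ^ s` is asymptotic to `m ^ (s + 1) / (s + 1)` for `s > -1`. -/
theorem tendsto_sum_Icc_rpow_div (s : ℝ) (hs : -1 < s) :
    Tendsto (fun m : ℕ => (∑ k ∈ Finset.Icc 1 m, (k : ℝ) ^ s) / (m : ℝ) ^ (s + 1))
      atTop (nhds (1 / (s + 1))) := by
  have hs' : 0 < s + 1 := by linarith
  set g : ℕ → ℝ := fun n => ((n : ℝ) + 1) ^ (s + 1) - (n : ℝ) ^ (s + 1) with hg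
  have hg_pos (n : ℕ) : 0 < g n :=
    sub_pos.2 (Real.rpow_lt_rpow n.cast_nonneg (lt_add_one _) hs')
  have hg_sum (n : ℕ) : ∑ i ∈ Finset.range n, g i = (n : ℝ) ^ (s + 1) := by
    have := Finset.sum_range_sub (fun i : ℕ => (i : ℝ) ^ (s + 1)) n
    simpa [hg, Real.zero_rpow hs'.ne'] using this
  have hshift (n : ℕ) :
      ∑ k ∈ Finset.Icc 1 n, (k : ℝ) ^ s = ∑ i ∈ Finset.range n, ((i : ℝ) + 1) ^ s := by
    induction n with
    | zero => simp
    | succ n ih => simp [Finset.sum_Icc_succ_top, Finset.sum_range_succ, ih]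
  have hratio : Tendsto (fun n : ℕ => (((n : ℝ) + 1) ^ s - 1 / (s + 1) * g n) / g n)
      atTop (nhds 0) := by
    have h := ((tendsto_rpow_add_one_sub_rpow_div s).inv₀ hs'.ne').sub_const (1 / (s + 1))
    rw [one_div, sub_self] at h
    refine h.congr fun n => ?_
    rw [inv_div, sub_div, mul_div_cancel_right₀ _ (hg_pos n).ne', one_div]
  have hlittle := (Asymptotics.isLittleO_of_tendsto
    (fun n h => absurd h (hg_pos n).ne') hratio).sum_range (fun n => (hg_pos n).le)
    (by simpa only [hg_sum, Function.comp_def] using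
      (tendsto_rpow_atTop hs').comp tendsto_natCast_atTop_atTop)
  have h := hlittle.tendsto_div_nhds_zero.add_const (1 / (s + 1))
  rw [zero_add] at h
  refine h.congr' ?_
  filter_upwards [eventually_gt_atTop 0] with n hn
  have hpow : (0 : ℝ) < (n : ℝ) ^ (s + 1) := by positivity
  rw [Finset.sum_sub_distrib, ← Finset.mul_sum, hg_sum, ← hshift, sub_div,
    mul_div_cancel_right₀ _ hpow.ne', sub_add_cancel]

/-- With schedule `t_k = Δt·k^α`, total time `T_m = ∑_{k=1}^m t_k`, cumulative information
`I_m = ∑_{k=1}^m t_k^{γ₀}` and exponent `p = (αγ₀+1)/(α+1)`, one has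
`lim_{m→∞} I_m / T_m^p = Δt^{γ₀-p}·(α+1)^p/(αγ₀+1)`; in particular `I_m = Θ(T_m^p)`. -/
theorem cumulative_fisher_limit (Δt α γ₀ : ℝ) (hΔt : 0 < Δt) (hα : -1 < α)
    (hαγ : -1 < α * γ₀) :
    Tendsto
      (fun m : ℕ =>
        (∑ k ∈ Finset.Icc 1 m, (Δt * (k : ℝ) ^ α) ^ γ₀) /
          (∑ k ∈ Finset.Icc 1 m, Δt * (k : ℝ) ^ α) ^ ((α * γ₀ + 1) / (α + 1)))
      atTop
      (nhds (Δt ^ (γ₀ - (α * γ₀ + 1) / (α + 1)) *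
        (α + 1) ^ ((α * γ₀ + 1) / (α + 1)) / (α * γ₀ + 1))) := by
  have hα' : 0 < α + 1 := by linarith
  set p := (α * γ₀ + 1) / (α + 1) with hp
  have hinv : (0 : ℝ) < 1 / (α + 1) := by positivity
  have hlim := ((tendsto_sum_Icc_rpow_div (α * γ₀) hαγ).div
    ((tendsto_sum_Icc_rpow_div α hα).rpow_const (p := p) (Or.inl hinv.ne'))
    (by positivity)).const_mul (Δt ^ (γ₀ - p))
  have hvalue : Δt ^ (γ₀ - p) * (1 / (α * γ₀ + 1) / (1 / (α + 1)) ^ p) =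
      Δt ^ (γ₀ - p) * (α + 1) ^ p / (α * γ₀ + 1) := by
    rw [Real.div_rpow zero_le_one hα'.le, Real.one_rpow]
    field_simp
  rw [hvalue] at hlim
  refine hlim.congr' ?_
  filter_upwards [eventually_gt_atTop 0] with m hm
  have hm' : (0 : ℝ) < m := by exact_mod_cast hm
  have hI : ∑ k ∈ Finset.Icc 1 m, (Δt * (k : ℝ) ^ α) ^ γ₀ =
      Δt ^ γ₀ * ∑ k ∈ Finset.Icc 1 m, (k : ℝ) ^ (α * γ₀) := by
    rw [Finset.mul_sum]
    refine Finset.sum_congr rfl fun k _ => ?_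
    rw [Real.mul_rpow hΔt.le (by positivity), ← Real.rpow_mul k.cast_nonneg]
  have hS : 0 ≤ ∑ k ∈ Finset.Icc 1 m, (k : ℝ) ^ α :=
    Finset.sum_nonneg fun k _ => by positivity
  have hexp : (α + 1) * p = α * γ₀ + 1 := mul_div_cancel₀ _ hα'.ne'
  have hpow : (0 : ℝ) < (m : ℝ) ^ (α * γ₀ + 1) := by positivity
  rw [Pi.div_apply, hI, ← Finset.mul_sum, Real.mul_rpow hΔt.le hS,
    Real.div_rpow hS (by positivity), ← Real.rpow_mul hm'.le, hexp,
    div_div_div_cancel_right₀ hpow.ne', Real.rpow_sub hΔt, div_mul_div_comm]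
end

section
/- Let Δt > 0 and let α, γ₀ be real numbers with α > −1 and αγ₀ > −1, and set p = (αγ₀ + 1)/(α + 1). Suppose F : (0,∞) → ℝ satisfies c·t^{γ₀} ≤ F(t) ≤ C·t^{γ₀} for all t > 0, for some constants 0 < c ≤ C. Then there exist constants c′, C′ > 0 and an integer m₀ such that for all m ≥ m₀, c′·T_m^{p} ≤ ∑_{k=1}^{m} F(t_k) ≤ C′·T_m^{p}; that is, the cumulative Fisher information ∑_{k=1}^{m} F(t_k) scales as Θ(T_m^{p}) with the total experiment time T_m. -/
theorem rpow_sub_rpow_sub_one_bounds {s x : ℝ} (hs : 0 < s) (hx : 1 ≤ x) :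
    min 1 s * x ^ (s - 1) ≤ x ^ s - (x - 1) ^ s ∧
      x ^ s - (x - 1) ^ s ≤ max 1 s * x ^ (s - 1) := by
  have hx0 : 0 < x := by linarith
  have hinv : x⁻¹ ≤ 1 := inv_le_one_of_one_le₀ hx
  have hinv0 : 0 < x⁻¹ := inv_pos.mpr hx0
  have hu : -1 ≤ -x⁻¹ := by linarith
  have hbase : 0 ≤ 1 + -x⁻¹ := by linarith
  have hbase1 : 1 + -x⁻¹ ≤ 1 := by linarith
  have hfactor : x - 1 = x * (1 + -x⁻¹) := by field_simp; ring
  have hpow : x ^ (s - 1) = x ^ s * x⁻¹ := by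
    rw [Real.rpow_sub_one hx0.ne', div_eq_mul_inv]
  have hxs : 0 < x ^ s := Real.rpow_pos_of_pos hx0 s
  rw [hfactor, Real.mul_rpow hx0.le hbase, hpow]
  rcases le_total 1 s with h | h
  · have h₁ := one_add_mul_self_le_rpow_one_add hu h
    have h₂ := Real.rpow_le_self_of_le_one hbase hbase1 h
    rw [min_eq_left h, max_eq_right h]
    constructor <;> nlinarith
  · have h₁ := rpow_one_add_le_one_add_mul_self hu hs.le h
    have h₂ := Real.self_le_rpow_of_le_one hbase hbase1 h
    rw [min_eq_right h, max_eq_left h]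
    constructor <;> nlinarith

theorem sum_Icc_rpow_bounds {s : ℝ} (hs : 0 < s) (m : ℕ) :
    min 1 s * ∑ k ∈ Finset.Icc 1 m, (k : ℝ) ^ (s - 1) ≤ (m : ℝ) ^ s ∧
      (m : ℝ) ^ s ≤ max 1 s * ∑ k ∈ Finset.Icc 1 m, (k : ℝ) ^ (s - 1) := by
  induction m with
  | zero => simp [Real.zero_rpow hs.ne']
  | succ n ih =>
    have h := rpow_sub_rpow_sub_one_bounds hs (x := ((n + 1 : ℕ) : ℝ))
      (by exact_mod_cast n.succ_pos)
    have hn : ((n + 1 : ℕ) : ℝ) - 1 = n := by push_cast; ring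
    rw [hn] at h
    rw [Finset.sum_Icc_succ_top (by omega), mul_add, mul_add]
    constructor <;> linarith [ih.1, ih.2, h.1, h.2]

/-- If the per-measurement Fisher information satisfies `c·t^γ₀ ≤ F(t) ≤ C·t^γ₀` for all
`t > 0`, then with the schedule `t_k = Δt·k^α` and total time `T_m = ∑_{k=1}^m t_k`, the
cumulative Fisher information `∑_{k=1}^m F(t_k)` scales as `Θ(T_m^p)` with
`p = (αγ₀+1)/(α+1)`. -/
theorem cumulative_fisher_theta (Δt α γ₀ : ℝ) (hΔt : 0 < Δt) (hα : -1 < α)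
    (hαγ : -1 < α * γ₀) (F : ℝ → ℝ) (c C : ℝ) (hc : 0 < c) (hcC : c ≤ C)
    (hF : ∀ t : ℝ, 0 < t → c * t ^ γ₀ ≤ F t ∧ F t ≤ C * t ^ γ₀) :
    ∃ c' C' : ℝ, 0 < c' ∧ 0 < C' ∧ ∃ m₀ : ℕ, ∀ m : ℕ, m₀ ≤ m →
      c' * (∑ k ∈ Finset.Icc 1 m, Δt * (k : ℝ) ^ α) ^ ((α * γ₀ + 1) / (α + 1)) ≤
          (∑ k ∈ Finset.Icc 1 m, F (Δt * (k : ℝ) ^ α)) ∧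
        (∑ k ∈ Finset.Icc 1 m, F (Δt * (k : ℝ) ^ α)) ≤
          C' * (∑ k ∈ Finset.Icc 1 m, Δt * (k : ℝ) ^ α) ^ ((α * γ₀ + 1) / (α + 1)) := by
  have ha : 0 < α + 1 := by linarith
  have hb : 0 < α * γ₀ + 1 := by linarith
  set a := α + 1 with ha_def
  set b := α * γ₀ + 1 with hb_def
  have hp : 0 < b / a := div_pos hb ha
  have hmin_a : 0 < min 1 a := lt_min one_pos ha
  have hmin_b : 0 < min 1 b := lt_min one_pos hb
  have hmax_a : 0 < max 1 a := lt_max_of_lt_left one_pos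
  have hmax_b : 0 < max 1 b := lt_max_of_lt_left one_pos
  have hC : 0 < C := hc.trans_le hcC
  have hD : 0 < Δt ^ γ₀ := Real.rpow_pos_of_pos hΔt γ₀
  have hL : 0 < (Δt / max 1 a) ^ (b / a) := Real.rpow_pos_of_pos (by positivity) _
  have hU : 0 < (Δt / min 1 a) ^ (b / a) := Real.rpow_pos_of_pos (by positivity) _
  refine ⟨c * Δt ^ γ₀ / max 1 b / (Δt / min 1 a) ^ (b / a),
    C * Δt ^ γ₀ / min 1 b / (Δt / max 1 a) ^ (b / a), by positivity, by positivity, 0, ?_⟩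
  intro m _
  obtain ⟨hA₁, hA₂⟩ := sum_Icc_rpow_bounds ha m
  obtain ⟨hB₁, hB₂⟩ := sum_Icc_rpow_bounds hb m
  rw [show a - 1 = α by simp [ha_def]] at hA₁ hA₂
  rw [show b - 1 = α * γ₀ by simp [hb_def]] at hB₁ hB₂
  have hF_term : ∀ k ∈ Finset.Icc 1 m,
      c * Δt ^ γ₀ * (k : ℝ) ^ (α * γ₀) ≤ F (Δt * (k : ℝ) ^ α) ∧
        F (Δt * (k : ℝ) ^ α) ≤ C * Δt ^ γ₀ * (k : ℝ) ^ (α * γ₀) := by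
    intro k hk
    have hk0 : (0 : ℝ) < k := by exact_mod_cast (Finset.mem_Icc.mp hk).1
    have hkα : 0 < (k : ℝ) ^ α := Real.rpow_pos_of_pos hk0 α
    have h := hF (Δt * (k : ℝ) ^ α) (by positivity)
    rwa [Real.mul_rpow hΔt.le hkα.le, ← Real.rpow_mul hk0.le, ← mul_assoc, ← mul_assoc] at h
  have hG₁ := Finset.sum_le_sum fun k hk => (hF_term k hk).1
  have hG₂ := Finset.sum_le_sum fun k hk => (hF_term k hk).2
  rw [← Finset.mul_sum] at hG₁ hG₂ ⊢
  have hA0 : 0 ≤ ∑ k ∈ Finset.Icc 1 m, (k : ℝ) ^ α :=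
    Finset.sum_nonneg fun k _ => Real.rpow_nonneg k.cast_nonneg α
  set A := ∑ k ∈ Finset.Icc 1 m, (k : ℝ) ^ α
  set B := ∑ k ∈ Finset.Icc 1 m, (k : ℝ) ^ (α * γ₀)
  have hma : 0 ≤ (m : ℝ) ^ a := Real.rpow_nonneg m.cast_nonneg a
  have hmab : ((m : ℝ) ^ a) ^ (b / a) = (m : ℝ) ^ b := by
    rw [← Real.rpow_mul m.cast_nonneg, mul_div_cancel₀ b ha.ne']
  have hT₁ : (Δt / max 1 a) ^ (b / a) * (m : ℝ) ^ b ≤ (Δt * A) ^ (b / a) := by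
    rw [← hmab, ← Real.mul_rpow (by positivity) hma]
    refine Real.rpow_le_rpow (by positivity) ?_ hp.le
    rw [div_mul_eq_mul_div, div_le_iff₀ hmax_a]
    nlinarith
  have hT₂ : (Δt * A) ^ (b / a) ≤ (Δt / min 1 a) ^ (b / a) * (m : ℝ) ^ b := by
    rw [← hmab, ← Real.mul_rpow (by positivity) hma]
    refine Real.rpow_le_rpow (by positivity) ?_ hp.le
    rw [div_mul_eq_mul_div, le_div_iff₀ hmin_a]
    nlinarith
  constructor
  · calc c * Δt ^ γ₀ / max 1 b / (Δt / min 1 a) ^ (b / a) * (Δt * A) ^ (b / a)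
        ≤ c * Δt ^ γ₀ / max 1 b / (Δt / min 1 a) ^ (b / a) *
            ((Δt / min 1 a) ^ (b / a) * (m : ℝ) ^ b) := by gcongr
      _ = c * Δt ^ γ₀ / max 1 b * (m : ℝ) ^ b := by field_simp
      _ ≤ c * Δt ^ γ₀ / max 1 b * (max 1 b * B) := by gcongr
      _ = c * Δt ^ γ₀ * B := by field_simp
      _ ≤ _ := hG₁
  · calc _ ≤ C * Δt ^ γ₀ * B := hG₂
      _ = C * Δt ^ γ₀ / min 1 b * (min 1 b * B) := by field_simp
      _ ≤ C * Δt ^ γ₀ / min 1 b * (m : ℝ) ^ b := by gcongr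
      _ = C * Δt ^ γ₀ / min 1 b / (Δt / max 1 a) ^ (b / a) *
            ((Δt / max 1 a) ^ (b / a) * (m : ℝ) ^ b) := by field_simp
      _ ≤ C * Δt ^ γ₀ / min 1 b / (Δt / max 1 a) ^ (b / a) * (Δt * A) ^ (b / a) := by gcongr
end

section
/- Let Δt > 0 and let α, γ₀ be real numbers with α > −1 and αγ₀ > −1, and set p = (αγ₀ + 1)/(α + 1). Suppose F : (0,∞) → ℝ satisfies c·t^{γ₀} ≤ F(t) ≤ C·t^{γ₀} for all t > 0, for some constants 0 < c ≤ C. Then the effective scaling exponent converges to p: lim_{m→∞} log(∑_{k=1}^{m} F(t_k)) / log(T_m) = p. -/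
open Filter

/-- Consecutive terms of a power sum, compared through Bernoulli's inequality (concave case). -/
theorem mul_rpow_le_rpow_sub_rpow {q x : ℝ} (hq : 0 < q) (hq1 : q ≤ 1) (hx : 1 ≤ x) :
    q * x ^ (q - 1) ≤ x ^ q - (x - 1) ^ q := by
  have hx0 : 0 < x := by linarith
  have hinv : x⁻¹ ≤ 1 := inv_le_one_of_one_le₀ hx
  have hb := rpow_one_add_le_one_add_mul_self (s := -x⁻¹) (by linarith) hq.le hq1
  have hfac : (x - 1) ^ q = x ^ q * (1 + -x⁻¹) ^ q := by
    rw [← Real.mul_rpow hx0.le (by linarith)]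
    congr 1
    field_simp
    ring
  rw [hfac, Real.rpow_sub_one hx0.ne', div_eq_mul_inv]
  nlinarith [mul_le_mul_of_nonneg_left hb (Real.rpow_pos_of_pos hx0 q).le]

/-- Consecutive terms of a power sum, compared through Bernoulli's inequality (convex case). -/
theorem rpow_sub_rpow_le_mul_rpow {q x : ℝ} (hq1 : 1 ≤ q) (hx : 1 ≤ x) :
    x ^ q - (x - 1) ^ q ≤ q * x ^ (q - 1) := by
  have hx0 : 0 < x := by linarith
  have hinv : x⁻¹ ≤ 1 := inv_le_one_of_one_le₀ hx
  have hb := one_add_mul_self_le_rpow_one_add (s := -x⁻¹) (by linarith) hq1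
  have hfac : (x - 1) ^ q = x ^ q * (1 + -x⁻¹) ^ q := by
    rw [← Real.mul_rpow hx0.le (by linarith)]
    congr 1
    field_simp
    ring
  rw [hfac, Real.rpow_sub_one hx0.ne', div_eq_mul_inv]
  nlinarith [mul_le_mul_of_nonneg_left hb (Real.rpow_pos_of_pos hx0 q).le]

theorem sum_Icc_rpow_sub_rpow {q : ℝ} (hq : 0 < q) (m : ℕ) :
    ∑ k ∈ Finset.Icc 1 m, ((k : ℝ) ^ q - ((k : ℝ) - 1) ^ q) = (m : ℝ) ^ q := by
  induction m with
  | zero => simp [Real.zero_rpow hq.ne']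
  | succ n ih =>
    rw [Finset.sum_Icc_succ_top (by omega), ih]
    push_cast
    rw [add_sub_cancel_right]
    ring

/-- Power sums with exponent `s > -1` grow like `m ^ (s + 1)`. -/
theorem exists_bounds_sum_Icc_rpow {s : ℝ} (hs : -1 < s) :
    ∃ A B : ℝ, 0 < A ∧ 0 < B ∧ ∀ m : ℕ, 1 ≤ m →
      A * (m : ℝ) ^ (s + 1) ≤ ∑ k ∈ Finset.Icc 1 m, (k : ℝ) ^ s ∧
        ∑ k ∈ Finset.Icc 1 m, (k : ℝ) ^ s ≤ B * (m : ℝ) ^ (s + 1) := by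
  have hq : 0 < s + 1 := by linarith
  have hconst : ∀ m : ℕ, 1 ≤ m →
      ∑ _k ∈ Finset.Icc 1 m, (m : ℝ) ^ s = (m : ℝ) ^ (s + 1) := by
    intro m hm
    have hm0 : (0 : ℝ) < m := by exact_mod_cast hm
    rw [Finset.sum_const, Nat.card_Icc, nsmul_eq_mul, Real.rpow_add_one hm0.ne']
    simp [mul_comm]
  rcases le_total s 0 with h0 | h0
  · refine ⟨1, (s + 1)⁻¹, one_pos, inv_pos.2 hq, fun m hm => ⟨?_, ?_⟩⟩
    · rw [one_mul, ← hconst m hm]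
      refine Finset.sum_le_sum fun k hk => ?_
      rw [Finset.mem_Icc] at hk
      exact Real.rpow_le_rpow_of_nonpos (by exact_mod_cast hk.1) (by exact_mod_cast hk.2) h0
    · rw [le_inv_mul_iff₀ hq, ← sum_Icc_rpow_sub_rpow hq, Finset.mul_sum]
      refine Finset.sum_le_sum fun k hk => ?_
      rw [Finset.mem_Icc] at hk
      simpa using mul_rpow_le_rpow_sub_rpow (x := k) hq (by linarith) (by exact_mod_cast hk.1)
  · refine ⟨(s + 1)⁻¹, 1, inv_pos.2 hq, one_pos, fun m hm => ⟨?_, ?_⟩⟩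
    · rw [inv_mul_le_iff₀ hq, ← sum_Icc_rpow_sub_rpow hq, Finset.mul_sum]
      refine Finset.sum_le_sum fun k hk => ?_
      rw [Finset.mem_Icc] at hk
      simpa using rpow_sub_rpow_le_mul_rpow (q := s + 1) (x := k) (by linarith)
        (by exact_mod_cast hk.1)
    · rw [one_mul, ← hconst m hm]
      refine Finset.sum_le_sum fun k hk => ?_
      rw [Finset.mem_Icc] at hk
      exact Real.rpow_le_rpow (by positivity) (by exact_mod_cast hk.2) h0

/-- A sequence of order `m ^ q` has logarithmic growth exponent `q`. -/
theorem tendsto_log_div_log_of_rpow_bounds {f : ℕ → ℝ} {A B q : ℝ} (hA : 0 < A) (hB : 0 < B)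
    (hf : ∀ m : ℕ, 1 ≤ m → A * (m : ℝ) ^ q ≤ f m ∧ f m ≤ B * (m : ℝ) ^ q) :
    Tendsto (fun m : ℕ => Real.log (f m) / Real.log m) atTop (nhds q) := by
  have hlog : Tendsto (fun m : ℕ => Real.log (m : ℝ)) atTop atTop :=
    Real.tendsto_log_atTop.comp tendsto_natCast_atTop_atTop
  have hlim : ∀ D : ℝ, Tendsto (fun m : ℕ => D / Real.log m + q) atTop (nhds q) := by
    intro D
    simpa using (hlog.const_div_atTop D).add_const q
  have hexp : ∀ D : ℝ, 0 < D → ∀ m : ℕ, 2 ≤ m →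
      D.log / Real.log m + q = Real.log (D * (m : ℝ) ^ q) / Real.log m := by
    intro D hD m hm
    have hm1 : (1 : ℝ) < m := by exact_mod_cast hm
    have hm0 : (0 : ℝ) < m := by linarith
    have hl : Real.log m ≠ 0 := (Real.log_pos hm1).ne'
    rw [Real.log_mul hD.ne' (Real.rpow_pos_of_pos hm0 q).ne', Real.log_rpow hm0]
    field_simp
  refine tendsto_of_tendsto_of_tendsto_of_le_of_le' (hlim A.log) (hlim B.log) ?_ ?_
  · filter_upwards [eventually_ge_atTop 2] with m hm
    have hm0 : (0 : ℝ) < m := by exact_mod_cast (by omega : 0 < m)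
    rw [hexp A hA m hm]
    exact div_le_div_of_nonneg_right
      (Real.log_le_log (by positivity) (hf m (by omega)).1) (Real.log_natCast_nonneg m)
  · filter_upwards [eventually_ge_atTop 2] with m hm
    have hm0 : (0 : ℝ) < m := by exact_mod_cast (by omega : 0 < m)
    have hfm := hf m (by omega)
    rw [hexp B hB m hm]
    exact div_le_div_of_nonneg_right
      (Real.log_le_log (lt_of_lt_of_le (by positivity) hfm.1) hfm.2) (Real.log_natCast_nonneg m)

/-- Sums of terms of order `k ^ s`, with `s > -1`, have logarithmic growth exponent `s + 1`. -/
theorem tendsto_log_sum_div_log {g : ℕ → ℝ} {a b s : ℝ} (hs : -1 < s) (ha : 0 < a) (hb : 0 < b)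
    (hg : ∀ k : ℕ, 1 ≤ k → a * (k : ℝ) ^ s ≤ g k ∧ g k ≤ b * (k : ℝ) ^ s) :
    Tendsto (fun m : ℕ => Real.log (∑ k ∈ Finset.Icc 1 m, g k) / Real.log m) atTop
      (nhds (s + 1)) := by
  obtain ⟨A, B, hA, hB, hAB⟩ := exists_bounds_sum_Icc_rpow hs
  refine tendsto_log_div_log_of_rpow_bounds (mul_pos ha hA) (mul_pos hb hB) fun m hm => ⟨?_, ?_⟩
  · calc a * A * (m : ℝ) ^ (s + 1) = a * (A * (m : ℝ) ^ (s + 1)) := mul_assoc _ _ _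
      _ ≤ a * ∑ k ∈ Finset.Icc 1 m, (k : ℝ) ^ s := mul_le_mul_of_nonneg_left (hAB m hm).1 ha.le
      _ = ∑ k ∈ Finset.Icc 1 m, a * (k : ℝ) ^ s := Finset.mul_sum _ _ _
      _ ≤ _ := Finset.sum_le_sum fun k hk => (hg k (Finset.mem_Icc.1 hk).1).1
  · calc ∑ k ∈ Finset.Icc 1 m, g k ≤ ∑ k ∈ Finset.Icc 1 m, b * (k : ℝ) ^ s :=
          Finset.sum_le_sum fun k hk => (hg k (Finset.mem_Icc.1 hk).1).2
      _ = b * ∑ k ∈ Finset.Icc 1 m, (k : ℝ) ^ s := (Finset.mul_sum _ _ _).symm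
      _ ≤ b * (B * (m : ℝ) ^ (s + 1)) := mul_le_mul_of_nonneg_left (hAB m hm).2 hb.le
      _ = _ := (mul_assoc _ _ _).symm

/-- If the per-measurement Fisher information satisfies `c·t^γ₀ ≤ F(t) ≤ C·t^γ₀` for all
`t > 0`, then with the schedule `t_k = Δt·k^α` and total time `T_m = ∑_{k=1}^m t_k`, the
effective scaling exponent converges:
`lim_{m→∞} log(∑_{k=1}^m F(t_k)) / log(T_m) = (αγ₀+1)/(α+1)`. -/
theorem effective_exponent_limit (Δt α γ₀ : ℝ) (hΔt : 0 < Δt) (hα : -1 < α)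
    (hαγ : -1 < α * γ₀) (F : ℝ → ℝ) (c C : ℝ) (hc : 0 < c) (hcC : c ≤ C)
    (hF : ∀ t : ℝ, 0 < t → c * t ^ γ₀ ≤ F t ∧ F t ≤ C * t ^ γ₀) :
    Tendsto
      (fun m : ℕ =>
        Real.log (∑ k ∈ Finset.Icc 1 m, F (Δt * (k : ℝ) ^ α)) /
          Real.log (∑ k ∈ Finset.Icc 1 m, Δt * (k : ℝ) ^ α))
      atTop (nhds ((α * γ₀ + 1) / (α + 1))) := by
  have hT := tendsto_log_sum_div_log (g := fun k : ℕ => Δt * (k : ℝ) ^ α) hα hΔt hΔt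
    fun k _ => ⟨le_rfl, le_rfl⟩
  have hD : 0 < Δt ^ γ₀ := Real.rpow_pos_of_pos hΔt γ₀
  have hS := tendsto_log_sum_div_log (g := fun k : ℕ => F (Δt * (k : ℝ) ^ α)) hαγ
    (mul_pos hc hD) (mul_pos (hc.trans_le hcC) hD) fun k hk => by
      have hk0 : (0 : ℝ) < k := by exact_mod_cast hk
      have hpow := Real.rpow_pos_of_pos hk0 α
      have h := hF _ (mul_pos hΔt hpow)
      rwa [Real.mul_rpow hΔt.le hpow.le, ← Real.rpow_mul hk0.le, ← mul_assoc, ← mul_assoc] at h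
  refine (hS.div hT (by linarith)).congr' ?_
  filter_upwards [eventually_ge_atTop 2] with m hm
  have hm1 : (1 : ℝ) < m := by exact_mod_cast hm
  exact div_div_div_cancel_right₀ (Real.log_pos hm1).ne' _ _
end

section
/- Let Δt > 0 and α > −1 be real. For T > 0 define m(T) to be the largest integer m ≥ 0 with ∑_{k=1}^{m} Δt·k^α ≤ T. Then lim_{T→∞} m(T) / ((α+1)·T/Δt)^{1/(α+1)} = 1; that is, the number of measurements achievable within total experiment time T satisfies m(T) ∼ ((α+1)T/Δt)^{1/(α+1)}. -/
open Filter

/-- Backward differences of `x ^ p / p` along the integers are asymptotic to `x ^ (p - 1)`. -/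
lemma tendsto_rpow_sub_rpow_div {p : ℝ} (hp : 0 < p) :
    Tendsto (fun k : ℕ => (((k : ℝ) + 1) ^ p - (k : ℝ) ^ p) / p / ((k : ℝ) + 1) ^ (p - 1))
      atTop (nhds 1) := by
  have hd : HasDerivAt (fun x : ℝ => x ^ p) p 1 := by
    simpa using Real.hasDerivAt_rpow_const (x := 1) (p := p) (Or.inl one_ne_zero)
  have hseq : Tendsto (fun k : ℕ => (k : ℝ) / ((k : ℝ) + 1)) atTop (nhdsWithin 1 {1}ᶜ) := by
    refine tendsto_nhdsWithin_iff.2 ⟨tendsto_natCast_div_add_atTop 1, .of_forall fun k => ?_⟩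
    have : (0 : ℝ) < (k : ℝ) + 1 := by positivity
    simp only [Set.mem_compl_iff, Set.mem_singleton_iff, div_eq_one_iff_eq this.ne']
    linarith
  have h := ((hasDerivAt_iff_tendsto_slope.1 hd).comp hseq).div_const p
  rw [div_self hp.ne'] at h
  refine h.congr fun k => ?_
  have hk : (0 : ℝ) < (k : ℝ) + 1 := by positivity
  have hkp : (0 : ℝ) < ((k : ℝ) + 1) ^ p := by positivity
  have h1 : (k : ℝ) / ((k : ℝ) + 1) - 1 = -1 / ((k : ℝ) + 1) := by
    field_simp
    ring
  simp only [Function.comp, slope_def_field, Real.one_rpow, h1,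
    Real.div_rpow (Nat.cast_nonneg k) hk.le, Real.rpow_sub_one hk.ne']
  field_simp
  ring

/-- `∑_{k=1}^n k^α ∼ n^(α+1) / (α+1)` for `α > -1`. -/
lemma tendsto_sum_rpow_div {α : ℝ} (hα : -1 < α) :
    Tendsto (fun n : ℕ => (α + 1) * (∑ k ∈ Finset.Icc 1 n, (k : ℝ) ^ α) / (n : ℝ) ^ (α + 1))
      atTop (nhds 1) := by
  have hp : 0 < α + 1 := by linarith
  set g : ℕ → ℝ := fun k => (((k : ℝ) + 1) ^ (α + 1) - (k : ℝ) ^ (α + 1)) / (α + 1) with hg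
  have hsum : ∀ n, ∑ k ∈ Finset.range n, g k = (n : ℝ) ^ (α + 1) / (α + 1) := by
    intro n
    have := Finset.sum_range_sub (fun k : ℕ => (k : ℝ) ^ (α + 1)) n
    simp only [Nat.cast_add, Nat.cast_one, Nat.cast_zero, Real.zero_rpow hp.ne', sub_zero] at this
    rw [hg, ← Finset.sum_div, this]
  have hg0 : ∀ k, 0 < g k := by
    intro k
    refine div_pos (sub_pos.2 ?_) hp
    exact Real.rpow_lt_rpow (Nat.cast_nonneg k) (by linarith) hp
  have hlim := tendsto_rpow_sub_rpow_div hp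
  rw [add_sub_cancel_right] at hlim
  have hequiv : Asymptotics.IsEquivalent atTop (fun k : ℕ => ((k : ℝ) + 1) ^ α) g := by
    refine (Asymptotics.isEquivalent_of_tendsto_one ?_).symm
    exact hlim
  have hdiv : Tendsto (fun n : ℕ => (n : ℝ) ^ (α + 1) / (α + 1)) atTop atTop :=
    ((tendsto_rpow_atTop hp).comp tendsto_natCast_atTop_atTop).atTop_div_const hp
  have hlo := Asymptotics.IsLittleO.sum_range hequiv.isLittleO (fun k => (hg0 k).le)
    (by simpa only [hsum] using hdiv)
  have hS : Asymptotics.IsEquivalent atTop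
      (fun n : ℕ => ∑ k ∈ Finset.Icc 1 n, (k : ℝ) ^ α)
      (fun n : ℕ => (n : ℝ) ^ (α + 1) / (α + 1)) := by
    refine hlo.congr (fun n => ?_) hsum
    simp only [Pi.sub_apply, Finset.sum_sub_distrib, hsum]
    congr 1
    have h := Finset.sum_Ico_add' (fun k : ℕ => (k : ℝ) ^ α) 0 n 1
    push_cast at h
    rw [Finset.range_eq_Ico, h]
    rfl
  have hne : ∀ᶠ n : ℕ in atTop, (n : ℝ) ^ (α + 1) / (α + 1) ≠ 0 :=
    (hdiv.eventually_gt_atTop 0).mono fun _ h => h.ne'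
  refine ((Asymptotics.isEquivalent_iff_tendsto_one hne).1 hS).congr fun n => ?_
  simp only [Pi.div_apply]
  rw [div_div_eq_mul_div, mul_comm]

/-- Let `m(T)` be the largest integer `m ≥ 0` with `∑_{k=1}^m Δt·k^α ≤ T`.  Then
`m(T) ∼ ((α+1)·T/Δt)^(1/(α+1))` as `T → ∞`. -/
theorem measurement_count_asymptotic (Δt α : ℝ) (hΔt : 0 < Δt) (hα : -1 < α)
    (m : ℝ → ℕ)
    (hm : ∀ T : ℝ, 0 < T →
      (∑ k ∈ Finset.Icc 1 (m T), Δt * (k : ℝ) ^ α) ≤ T ∧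
        ∀ m' : ℕ, (∑ k ∈ Finset.Icc 1 m', Δt * (k : ℝ) ^ α) ≤ T → m' ≤ m T) :
    Tendsto (fun T : ℝ => (m T : ℝ) / ((α + 1) * T / Δt) ^ (1 / (α + 1)))
      atTop (nhds 1) := by
  have hp : 0 < α + 1 := by linarith
  have hm_top : Tendsto m atTop atTop := by
    refine tendsto_atTop.2 fun N => ?_
    filter_upwards [eventually_gt_atTop 0,
      eventually_ge_atTop (∑ k ∈ Finset.Icc 1 N, Δt * (k : ℝ) ^ α)] with T hT hN
    exact (hm T hT).2 N hN
  have hlow := tendsto_sum_rpow_div hα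
  have hupp : Tendsto (fun n : ℕ => (α + 1) * (∑ k ∈ Finset.Icc 1 (n + 1), (k : ℝ) ^ α) /
      (n : ℝ) ^ (α + 1)) atTop (nhds 1) := by
    have h1 : Tendsto (fun n : ℕ => ((n : ℝ) / ((n : ℝ) + 1)) ^ (α + 1)) atTop (nhds 1) := by
      simpa using (tendsto_natCast_div_add_atTop (1 : ℝ)).rpow_const
        (p := α + 1) (Or.inl one_ne_zero)
    have h2 := (hlow.comp (tendsto_add_atTop_nat 1)).div h1 one_ne_zero
    rw [div_one] at h2
    refine h2.congr' ?_
    filter_upwards [eventually_gt_atTop 0] with n hn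
    have hn' : (0 : ℝ) < n := by exact_mod_cast hn
    have : (0 : ℝ) < (n : ℝ) ^ (α + 1) := by positivity
    have : (0 : ℝ) < ((n : ℝ) + 1) ^ (α + 1) := by positivity
    simp only [Pi.div_apply, Function.comp, Nat.cast_add, Nat.cast_one]
    rw [Real.div_rpow hn'.le (by positivity)]
    field_simp
  have hratio : Tendsto (fun T : ℝ => ((α + 1) * T / Δt) / (m T : ℝ) ^ (α + 1))
      atTop (nhds 1) := by
    refine tendsto_of_tendsto_of_tendsto_of_le_of_le' (hlow.comp hm_top) (hupp.comp hm_top) ?_ ?_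
    · filter_upwards [eventually_gt_atTop 0] with T hT
      have h := (hm T hT).1
      rw [← Finset.mul_sum, ← le_div_iff₀' hΔt] at h
      simp only [Function.comp, mul_div_assoc (α + 1) T]
      gcongr
    · filter_upwards [eventually_gt_atTop 0] with T hT
      have h : T ≤ ∑ k ∈ Finset.Icc 1 (m T + 1), Δt * (k : ℝ) ^ α := by
        by_contra! hlt
        exact absurd ((hm T hT).2 _ hlt.le) (by simp)
      rw [← Finset.mul_sum, ← div_le_iff₀' hΔt] at h
      simp only [Function.comp, mul_div_assoc (α + 1) T]
      gcongr
  have hfin := (hratio.rpow_const (p := 1 / (α + 1)) (Or.inl one_ne_zero)).inv₀ (by simp)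
  rw [Real.one_rpow, inv_one] at hfin
  refine hfin.congr' ?_
  filter_upwards [eventually_gt_atTop 0] with T hT
  rw [Real.div_rpow (by positivity) (by positivity), ← Real.rpow_mul (Nat.cast_nonneg _),
    mul_one_div_cancel hp.ne', Real.rpow_one, inv_div]
end

section
/- For any nonzero vectors u, v ∈ ℂ², the set {U ∈ SU(2) : ⟨u, U·v⟩ = 0} has Haar measure zero: μ({U ∈ SU(2) : ⟨u, U·v⟩ = 0}) = 0. -/
open MeasureTheory Matrix

noncomputable section

/-- `SU(2)`: the subgroup of the `2 × 2` complex unitary group consisting of matrices of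
determinant `1`. -/
def SU2 : Subgroup (Matrix.unitaryGroup (Fin 2) ℂ) where
  carrier := {U | (U : Matrix (Fin 2) (Fin 2) ℂ).det = 1}
  one_mem' := by simp
  mul_mem' := by
    intro a b ha hb
    simp only [Set.mem_setOf_eq] at *
    rw [Matrix.UnitaryGroup.mul_val, Matrix.det_mul, ha, hb, mul_one]
  inv_mem' := by
    intro a ha
    simp only [Set.mem_setOf_eq] at *
    rw [Matrix.UnitaryGroup.inv_val, Matrix.star_eq_conjTranspose,
      Matrix.det_conjTranspose, ha, star_one]

/-- The underlying `2 × 2` complex matrix of an element of `SU(2)`. -/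
def SU2.mat (U : SU2) : Matrix (Fin 2) (Fin 2) ℂ := U.1.1

/-- The Hermitian inner product `⟨u, v⟩ = ∑ i, conj (u i) * v i`, conjugate-linear in the
first argument. -/
def hInner {ι : Type*} [Fintype ι] (u v : ι → ℂ) : ℂ :=
  ∑ i, starRingEnd ℂ (u i) * v i

/-- The set of `U ∈ SU(2)` such that `U v` is orthogonal to `u`. -/
def SU2.overlapZeroSet (u v : Fin 2 → ℂ) : Set SU2 :=
  {U : SU2 | hInner u ((SU2.mat U).mulVec v) = 0}

lemma SU2.continuous_mat : Continuous SU2.mat :=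
  continuous_subtype_val.comp continuous_subtype_val

lemma SU2.isClosed_overlapZeroSet (u v : Fin 2 → ℂ) :
    IsClosed (SU2.overlapZeroSet u v) := by
  have h : Continuous fun U : SU2 => hInner u ((SU2.mat U).mulVec v) := by
    unfold hInner
    have h' : Continuous fun U : SU2 => (SU2.mat U).mulVec v :=
      SU2.continuous_mat.matrix_mulVec continuous_const
    fun_prop
  exact isClosed_eq h continuous_const

/-- Every nonzero vector of `ℂ²` is a nonzero real multiple of the first column of an element of
`SU(2)`. -/
lemma SU2.exists_col_zero {u : Fin 2 → ℂ} (hu : u ≠ 0) :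
    ∃ (g : SU2) (r : ℝ), r ≠ 0 ∧ ∀ i, u i = r * SU2.mat g i 0 := by
  set s : ℝ := Complex.normSq (u 0) + Complex.normSq (u 1) with hs
  have hpos : 0 < s := by
    by_contra! h
    have h0 := Complex.normSq_nonneg (u 0)
    have h1 := Complex.normSq_nonneg (u 1)
    refine hu (funext fun i => ?_)
    fin_cases i
    · exact Complex.normSq_eq_zero.mp (by linarith : Complex.normSq (u 0) = 0)
    · exact Complex.normSq_eq_zero.mp (by linarith : Complex.normSq (u 1) = 0)
  set r : ℝ := Real.sqrt s
  have hr : (r : ℂ) ≠ 0 := by exact_mod_cast (Real.sqrt_pos.mpr hpos).ne'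
  have hr2 : (r : ℂ) ^ 2 =
      u 0 * starRingEnd ℂ (u 0) + u 1 * starRingEnd ℂ (u 1) := by
    rw [Complex.mul_conj, Complex.mul_conj]
    exact_mod_cast Real.sq_sqrt hpos.le
  let M : Matrix (Fin 2) (Fin 2) ℂ :=
    !![u 0 / r, -(starRingEnd ℂ (u 1) / r); u 1 / r, starRingEnd ℂ (u 0) / r]
  have hM : M ∈ Matrix.unitaryGroup (Fin 2) ℂ := by
    rw [Matrix.mem_unitaryGroup_iff]
    ext i j
    fin_cases i <;> fin_cases j <;>
      simp [M, Matrix.mul_apply, Fin.sum_univ_two, Matrix.star_apply] <;>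
      field_simp <;> simp [hr2] <;> ring
  have hdet : M.det = 1 := by
    simp only [M, Matrix.det_fin_two_of]
    field_simp
    rw [hr2]
    ring
  refine ⟨⟨⟨M, hM⟩, hdet⟩, r, by exact_mod_cast hr, fun i => ?_⟩
  fin_cases i <;> simp [SU2.mat, M] <;> field_simp

lemma SU2.measure_overlapZeroSet [MeasurableSpace SU2] [BorelSpace SU2]
    (μ : Measure SU2) [μ.IsMulLeftInvariant] {u : Fin 2 → ℂ} (hu : u ≠ 0) (v : Fin 2 → ℂ) :
    μ (SU2.overlapZeroSet u v) = μ (SU2.overlapZeroSet ![1, 0] v) := by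
  obtain ⟨g, r, hr, hg⟩ := SU2.exists_col_zero hu
  rw [← measure_preimage_mul μ g (SU2.overlapZeroSet u v)]
  congr 1
  ext U
  have hmul : SU2.mat (g * U) = SU2.mat g * SU2.mat U := rfl
  have hunit : star (SU2.mat g) * SU2.mat g = 1 := Matrix.mem_unitaryGroup_iff'.mp g.1.2
  have h00 := congrFun (congrFun hunit 0) 0
  have h01 := congrFun (congrFun hunit 0) 1
  simp only [Matrix.mul_apply, Fin.sum_univ_two, Matrix.star_apply, Matrix.one_apply_eq,
    RCLike.star_def] at h00
  simp only [Matrix.mul_apply, Fin.sum_univ_two, Matrix.star_apply, RCLike.star_def,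
    Matrix.one_apply_ne (zero_ne_one : (0 : Fin 2) ≠ 1)] at h01
  have key : hInner u ((SU2.mat (g * U)).mulVec v) =
      r * hInner ![1, 0] ((SU2.mat U).mulVec v) := by
    rw [hmul, ← Matrix.mulVec_mulVec]
    generalize (SU2.mat U).mulVec v = w
    simp only [hInner, Fin.sum_univ_two, Matrix.mulVec, dotProduct, hg, map_mul,
      Complex.conj_ofReal, Matrix.cons_val_zero, Matrix.cons_val_one, map_one, map_zero]
    linear_combination (r * w 0) * h00 + (r * w 1) * h01
  change hInner u ((SU2.mat (g * U)).mulVec v) = 0 ↔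
    hInner ![1, 0] ((SU2.mat U).mulVec v) = 0
  rw [key, mul_eq_zero, or_iff_right (Complex.ofReal_ne_zero.mpr hr)]

lemma SU2.mat_mulVec_ne_zero (U : SU2) {v : Fin 2 → ℂ} (hv : v ≠ 0) :
    (SU2.mat U).mulVec v ≠ 0 := fun h => by
  have hunit : star (SU2.mat U) * SU2.mat U = 1 := Matrix.mem_unitaryGroup_iff'.mp U.1.2
  apply hv
  rw [← Matrix.one_mulVec v, ← hunit, ← Matrix.mulVec_mulVec, h, Matrix.mulVec_zero]

lemma SU2.pairwise_disjoint_overlapZeroSet {v : Fin 2 → ℂ} (hv : v ≠ 0) :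
    Pairwise fun m n : ℕ =>
      Disjoint (SU2.overlapZeroSet ![1, (m : ℂ)] v) (SU2.overlapZeroSet ![1, (n : ℂ)] v) := by
  intro m n hmn
  refine Set.disjoint_left.mpr fun U hm hn => SU2.mat_mulVec_ne_zero U hv ?_
  simp only [SU2.overlapZeroSet, Set.mem_ofPred_eq, hInner, Fin.sum_univ_two,
    Matrix.cons_val_zero, Matrix.cons_val_one, map_one, map_natCast] at hm hn
  have hmn' : (m : ℂ) - n ≠ 0 := sub_ne_zero.mpr (by exact_mod_cast hmn)
  have h1 : (SU2.mat U).mulVec v 1 = 0 :=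
    (mul_eq_zero.mp (by linear_combination hm - hn :
      ((m : ℂ) - n) * (SU2.mat U).mulVec v 1 = 0)).resolve_left hmn'
  have h0 : (SU2.mat U).mulVec v 0 = 0 := by linear_combination hm - m * h1
  ext i
  fin_cases i
  · exact h0
  · exact h1

/-- For any nonzero `u, v ∈ ℂ²`, the set `{U ∈ SU(2) : ⟨u, U·v⟩ = 0}` has Haar measure
zero. -/
theorem haar_measure_overlap_zero_set [MeasurableSpace SU2] [BorelSpace SU2]
    (μ : Measure SU2) [μ.IsHaarMeasure] [IsProbabilityMeasure μ]
    (u v : Fin 2 → ℂ) (hu : u ≠ 0) (hv : v ≠ 0) :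
    μ {U : SU2 | hInner u ((SU2.mat U).mulVec v) = 0} = 0 := by
  change μ (SU2.overlapZeroSet u v) = 0
  by_contra h
  have hfin := Measure.finite_const_le_meas_of_disjoint_iUnion μ (pos_iff_ne_zero.mpr h)
    (fun n : ℕ => (SU2.isClosed_overlapZeroSet ![1, (n : ℂ)] v).measurableSet)
    (SU2.pairwise_disjoint_overlapZeroSet hv) (measure_ne_top μ _)
  refine Set.infinite_univ (hfin.subset fun n _ => ?_)
  have hn : ![1, (n : ℂ)] ≠ 0 := fun h0 => one_ne_zero (congrFun h0 0)
  exact (SU2.measure_overlapZeroSet μ hu v).trans (SU2.measure_overlapZeroSet μ hn v).symm |>.le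

end
end

section
/- Let ψ be a one-local Haar-random product state on n qubits and let Q and Q′ be two distinct n-qubit Pauli strings, not both equal to the identity string. Then the product of their expectation values vanishes on average: E[⟨ψ, Qψ⟩·⟨ψ, Q′ψ⟩] = 0. -/
open MeasureTheory Matrix

noncomputable section

/-- The four single-qubit Pauli matrices `I, σ_x, σ_y, σ_z`. -/
def pauli : Fin 4 → Matrix (Fin 2) (Fin 2) ℂ
  | 0 => 1
  | 1 => !![0, 1; 1, 0]
  | 2 => !![0, -Complex.I; Complex.I, 0]
  | 3 => !![1, 0; 0, -1]

/-- The `n`-qubit Pauli string `τ₁ ⊗ ⋯ ⊗ τₙ`, as a matrix on `(ℂ²)^{⊗n}` (realized as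
functions `(Fin n → Fin 2) → ℂ`). -/
def pauliString {n : ℕ} (τ : Fin n → Fin 4) :
    Matrix (Fin n → Fin 2) (Fin n → Fin 2) ℂ :=
  fun x y => ∏ j, pauli (τ j) (x j) (y j)

/-- The elementary tensor `f 1 ⊗ ⋯ ⊗ f n` of single-qubit vectors, as a vector of
`(ℂ²)^{⊗n}` (realized as functions `(Fin n → Fin 2) → ℂ`). -/
def tensorVec {n : ℕ} (f : (j : Fin n) → Fin 2 → ℂ) : (Fin n → Fin 2) → ℂ :=
  fun x => ∏ j, f j (x j)


/-- The standard basis vector `e₀ = (1,0)ᵀ ∈ ℂ²`. -/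
def e0 : Fin 2 → ℂ := fun i => if i = 0 then 1 else 0

/-- The one-local Haar-random product state `ψ = (U₁ ⊗ ⋯ ⊗ Uₙ) e₀^{⊗n}` determined by
`U : Fin n → SU(2)` (the randomness lies in choosing `U` according to the product of Haar
measures). -/
def spreadState {n : ℕ} (U : Fin n → SU2) : (Fin n → Fin 2) → ℂ :=
  tensorVec fun j => (SU2.mat (U j)).mulVec e0

/-- The expectation value of the Pauli matrix `pauli p` in the (unnormalised) state `u`. -/
def pauliExp (p : Fin 4) (u : Fin 2 → ℂ) : ℂ :=
  hInner u ((pauli p).mulVec u)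

/-- The sign `s` with `pauli k * pauli p = s • pauli p * pauli k`. -/
def pauliSign (k p : Fin 4) : ℤ :=
  if k = 0 ∨ p = 0 ∨ k = p then 1 else -1

lemma exists_pauliSign_mul_eq_neg_one {p q : Fin 4} (h : p ≠ q) :
    ∃ k : Fin 4, k ≠ 0 ∧ pauliSign k p * pauliSign k q = -1 := by
  revert p q
  decide

lemma pauliExp_I_smul_pauli_mulVec (k p : Fin 4) (u : Fin 2 → ℂ) :
    pauliExp p ((Complex.I • pauli k).mulVec u) = pauliSign k p * pauliExp p u := by
  fin_cases k <;> fin_cases p <;>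
    simp [pauliExp, pauliSign, pauli, hInner, Matrix.mulVec, dotProduct, Fin.sum_univ_two] <;>
    ring_nf <;> simp <;> ring

lemma exists_mat_eq_I_smul_pauli {k : Fin 4} (hk : k ≠ 0) :
    ∃ V : SU2, SU2.mat V = Complex.I • pauli k := by
  refine ⟨⟨⟨Complex.I • pauli k, ?_⟩, ?_⟩, rfl⟩
  · rw [Matrix.mem_unitaryGroup_iff]
    fin_cases k <;> ext i j <;> fin_cases i <;> fin_cases j <;>
      simp [pauli, Matrix.mul_apply, Matrix.star_apply]
  · change (Complex.I • pauli k).det = 1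
    fin_cases k <;> first | exact absurd rfl hk | simp [pauli, Matrix.det_fin_two]

lemma SU2.mat_mul (U V : SU2) : SU2.mat (U * V) = SU2.mat U * SU2.mat V := rfl

lemma hInner_pauliString_tensorVec {n : ℕ} (τ : Fin n → Fin 4) (f : Fin n → Fin 2 → ℂ) :
    hInner (tensorVec f) ((pauliString τ).mulVec (tensorVec f)) =
      ∏ j, pauliExp (τ j) (f j) := by
  simp only [pauliExp, hInner, tensorVec, pauliString, Matrix.mulVec, dotProduct,
    Finset.prod_univ_sum, Fintype.piFinset_univ, Finset.prod_mul_distrib, map_prod]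

lemma prod_pauliExp_mulSingle_mul {n : ℕ} (τ : Fin n → Fin 4) (U : Fin n → SU2) (j : Fin n)
    {k : Fin 4} {V : SU2} (hV : SU2.mat V = Complex.I • pauli k) :
    ∏ i, pauliExp (τ i) ((SU2.mat ((Pi.mulSingle j V * U : Fin n → SU2) i)).mulVec e0) =
      pauliSign k (τ j) * ∏ i, pauliExp (τ i) ((SU2.mat (U i)).mulVec e0) := by
  rw [← Finset.mul_prod_erase _ _ (Finset.mem_univ j),
    ← Finset.mul_prod_erase _ (fun i => pauliExp (τ i) ((SU2.mat (U i)).mulVec e0))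
      (Finset.mem_univ j), ← mul_assoc]
  congr 1
  · rw [Pi.mul_apply, Pi.mulSingle_eq_same, SU2.mat_mul, ← Matrix.mulVec_mulVec, hV,
      pauliExp_I_smul_pauli_mulVec]
  · refine Finset.prod_congr rfl fun i hi => ?_
    rw [Pi.mul_apply, Pi.mulSingle_eq_of_ne (Finset.ne_of_mem_erase hi), one_mul]

/-- For a one-local Haar-random product state `ψ` on `n` qubits and two distinct
`n`-qubit Pauli strings `Q ≠ Q′` (in particular not both the identity string), the product
of their expectation values vanishes on average: `E[⟨ψ, Qψ⟩·⟨ψ, Q′ψ⟩] = 0`. -/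
theorem pauli_expectation_cross_moment_zero [MeasurableSpace SU2] [BorelSpace SU2]
    (μ : Measure SU2) [μ.IsHaarMeasure] [IsProbabilityMeasure μ]
    (n : ℕ) (τ τ' : Fin n → Fin 4) (hττ' : τ ≠ τ') :
    (∫ U : Fin n → SU2,
        hInner (spreadState U) ((pauliString τ).mulVec (spreadState U)) *
          hInner (spreadState U) ((pauliString τ').mulVec (spreadState U))
        ∂(Measure.pi fun _ : Fin n => μ)) = 0 := by
  obtain ⟨j, hj⟩ := Function.ne_iff.mp hττ'
  obtain ⟨k, hk, hsign⟩ := exists_pauliSign_mul_eq_neg_one hj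
  obtain ⟨V, hV⟩ := exists_mat_eq_I_smul_pauli hk
  have hsign' : (pauliSign k (τ j) : ℂ) * pauliSign k (τ' j) = -1 := by exact_mod_cast hsign
  simp only [spreadState, hInner_pauliString_tensorVec]
  rw [← self_eq_neg, ← integral_neg,
    ← integral_mul_left_eq_self (μ := Measure.pi fun _ : Fin n => μ) _ (Pi.mulSingle j V)]
  congr 1 with U
  rw [prod_pauliExp_mulSingle_mul τ U j hV, prod_pauliExp_mulSingle_mul τ' U j hV,
    mul_mul_mul_comm, hsign', neg_one_mul]

end
end
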